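/- Let f: ℝ → ℝ be a bounded, positive, twice differentiable probability density with bounded second derivative, let a: ℝ → ℝ be positive, piecewise continuous and integrable, let 𝕂 be a kernel satisfying Assumption (A₁), and let (h_n) be a positive sequence decreasing to 0. Define L_n = ∫_ℝ ( ∫_ℝ 𝕂′(z) f(x − h_n z) dz )² a(x) dx. Then: (i) if ∫𝕂′(s)ds ≠ 0, lim_{n→∞} L_n = ( ∫f²(s)a(s)ds ) · ( ∫𝕂′(s)ds )²; (ii) if ∫𝕂′(s)ds = 0, lim_{n→∞} L_n/h_n² = ( ∫ f′(s)² a(s) ds ) · ( ∫ s·𝕂′(s) ds )². -/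

import Mathlib

open MeasureTheory Filter
open scoped Topology

noncomputable section

/-- Assumption (A₁) on the kernel `𝕂`: `𝕂‴` exists and is bounded,
`∫(|𝕂′|+|𝕂″|) < ∞`, `∫(𝕂″)² < ∞`, `∫|x𝕂′(x)|dx < ∞` and `∫x²|𝕂′(x)|dx < ∞`. -/
def AssumptionA1 (K : ℝ → ℝ) : Prop :=
  (∀ x, DifferentiableAt ℝ K x) ∧
  (∀ x, DifferentiableAt ℝ (deriv K) x) ∧
  (∀ x, DifferentiableAt ℝ (deriv (deriv K)) x) ∧
  (∃ M : ℝ, ∀ x, |deriv (deriv (deriv K)) x| ≤ M) ∧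
  Integrable (fun x => |deriv K x| + |deriv (deriv K) x|) ∧
  Integrable (fun x => (deriv (deriv K) x) ^ 2) ∧
  Integrable (fun x => |x * deriv K x|) ∧
  Integrable (fun x => x ^ 2 * |deriv K x|)

/-- `𝕂` is a kernel: nonnegative, bounded, continuous on its support, with
`∫𝕂 = 1`, `∫𝕂² < ∞` and `∫x²𝕂(x)dx < ∞`. -/
def IsKernel (K : ℝ → ℝ) : Prop :=
  (∀ x, 0 ≤ K x) ∧ (∃ M : ℝ, ∀ x, K x ≤ M) ∧
  ContinuousOn K (Function.support K) ∧
  Integrable K ∧ (∫ x, K x) = 1 ∧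
  Integrable (fun x => (K x) ^ 2) ∧
  Integrable (fun x => x ^ 2 * K x)

/-- Dominated convergence for `∫ (∫ F n x z dz)² a(x) dx` when `|F n x z| ≤ g z` with `g` integrable. -/
theorem tendsto_integral_sq_integral_mul {F : ℕ → ℝ → ℝ → ℝ} {F' : ℝ → ℝ → ℝ} {g a : ℝ → ℝ}
    (hF : ∀ n, Measurable (Function.uncurry (F n))) (hg : Integrable g)
    (hbound : ∀ n x z, |F n x z| ≤ g z)
    (hlim : ∀ x z, Tendsto (fun n => F n x z) atTop (𝓝 (F' x z))) (ha : Integrable a) :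
    Tendsto (fun n => ∫ x, (∫ z, F n x z) ^ 2 * a x) atTop
      (𝓝 (∫ x, (∫ z, F' x z) ^ 2 * a x)) := by
  have hinner : ∀ n, StronglyMeasurable (fun x => ∫ z, F n x z) := fun n =>
    (hF n).stronglyMeasurable.integral_prod_right
  refine tendsto_integral_of_dominated_convergence (fun x => (∫ z, g z) ^ 2 * |a x|) ?_ ?_ ?_ ?_
  · exact fun n => ((hinner n).pow 2).aestronglyMeasurable.mul ha.aestronglyMeasurable
  · exact ha.abs.const_mul _
  · refine fun n => Eventually.of_forall fun x => ?_
    have hle : |∫ z, F n x z| ≤ ∫ z, g z :=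
      norm_integral_le_of_norm_le (f := fun z => F n x z) hg
        (Eventually.of_forall fun z => hbound n x z)
    rw [Real.norm_eq_abs, abs_mul, abs_pow]
    gcongr
  · refine Eventually.of_forall fun x => ((Tendsto.pow ?_ 2).mul_const _)
    refine tendsto_integral_of_dominated_convergence g ?_ hg ?_ ?_
    · exact fun n => ((hF n).comp measurable_prodMk_left).aestronglyMeasurable
    · exact fun n => Eventually.of_forall fun z => hbound n x z
    · exact Eventually.of_forall fun z => hlim x z

/-- A function with values in `[0, B]` and second derivative bounded by `M` has derivative bounded
by `B + M`. -/
theorem abs_deriv_le_of_bounded {f : ℝ → ℝ} {B M : ℝ} (hf0 : ∀ x, 0 ≤ f x) (hfB : ∀ x, f x ≤ B)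
    (hf1 : Differentiable ℝ f) (hf2 : Differentiable ℝ (deriv f))
    (hM : ∀ x, |deriv (deriv f) x| ≤ M) (x : ℝ) : |deriv f x| ≤ B + M := by
  obtain ⟨c, ⟨hc1, hc2⟩, hc⟩ := exists_deriv_eq_slope f (show x < x + 1 by linarith)
    hf1.continuous.continuousOn hf1.differentiableOn
  rw [add_sub_cancel_left, div_one] at hc
  have hlip : |deriv f x - deriv f c| ≤ M * |x - c| :=
    Convex.norm_image_sub_le_of_norm_deriv_le (fun y _ => hf2 y) (fun y _ => hM y) convex_univ
      (Set.mem_univ c) (Set.mem_univ x)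
  have hxc : |x - c| ≤ 1 := abs_le.2 ⟨by linarith, by linarith⟩
  have hM0 : 0 ≤ M := (abs_nonneg _).trans (hM x)
  have hslope : |deriv f c| ≤ B := by
    rw [hc]
    exact abs_le.2 ⟨by linarith [hf0 (x + 1), hfB x], by linarith [hf0 x, hfB (x + 1)]⟩
  calc |deriv f x| = |deriv f c + (deriv f x - deriv f c)| := by rw [add_sub_cancel]
    _ ≤ |deriv f c| + |deriv f x - deriv f c| := abs_add_le _ _
    _ ≤ B + M := add_le_add hslope (hlip.trans (mul_le_of_le_one_right hM0 hxc))

/-- Difference quotients along `x - hₙ z`, with `hₙ → 0` nonvanishing. -/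
theorem tendsto_slope_sub_mul {f : ℝ → ℝ} {x : ℝ} (hf : DifferentiableAt ℝ f x) {h : ℕ → ℝ}
    (hne : ∀ n, h n ≠ 0) (hh0 : Tendsto h atTop (𝓝 0)) (z : ℝ) :
    Tendsto (fun n => (f (x - h n * z) - f x) / h n) atTop (𝓝 (-z * deriv f x)) := by
  have hd : HasDerivAt (fun t => f (x - t * z)) (-z * deriv f x) 0 := by
    have h1 : HasDerivAt (fun t : ℝ => x - t * z) (-z) 0 := by
      simpa using ((hasDerivAt_id (0 : ℝ)).mul_const z).const_sub x
    have h2 : HasDerivAt f (deriv f x) (x - 0 * z) := by simpa using hf.hasDerivAt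
    simpa [mul_comm, Function.comp_def] using h2.comp 0 h1
  have hh : Tendsto h atTop (𝓝[≠] 0) :=
    tendsto_nhdsWithin_iff.2 ⟨hh0, Eventually.of_forall hne⟩
  refine (hd.tendsto_slope_zero.comp hh).congr fun n => ?_
  simp [div_eq_inv_mul]

/-- limiting behavior of `L_n = ∫ (∫ 𝕂′(z) f(x - h_n z) dz)² a(x) dx`.
If `∫𝕂′ ≠ 0` then `L_n → (∫f²a)(∫𝕂′)²`; if `∫𝕂′ = 0` then
`L_n / h_n² → (∫(f′)²a)(∫s𝕂′(s)ds)²`. -/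
theorem Ln_limits
    (f a K : ℝ → ℝ) (h : ℕ → ℝ)
    -- f is a bounded positive twice differentiable density with bounded second derivative
    (hfpos : ∀ x, 0 < f x) (hfbdd : ∃ M : ℝ, ∀ x, f x ≤ M)
    (hfint : Integrable f) (hfdens : (∫ x, f x) = 1)
    (hfd1 : ∀ x, DifferentiableAt ℝ f x)
    (hfd2 : ∀ x, DifferentiableAt ℝ (deriv f) x)
    (hfd2bdd : ∃ M : ℝ, ∀ x, |deriv (deriv f) x| ≤ M)
    -- a is positive, piecewise continuous and integrable
    (hapos : ∀ x, 0 < a x)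
    (hacont : ∃ D : Set ℝ, D.Finite ∧ ContinuousOn a Dᶜ)
    (haint : Integrable a)
    -- 𝕂 is a kernel satisfying Assumption (A₁)
    (hK : IsKernel K) (hA1 : AssumptionA1 K)
    -- (h_n) is a positive sequence decreasing to 0
    (hhpos : ∀ n, 0 < h n) (hhanti : Antitone h)
    (hh0 : Filter.Tendsto h atTop (nhds 0)) :
    ((∫ s, deriv K s) ≠ 0 →
      Tendsto (fun n => ∫ x, (∫ z, deriv K z * f (x - h n * z)) ^ 2 * a x) atTop
        (𝓝 ((∫ s, (f s) ^ 2 * a s) * (∫ s, deriv K s) ^ 2))) ∧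
    ((∫ s, deriv K s) = 0 →
      Tendsto (fun n => (∫ x, (∫ z, deriv K z * f (x - h n * z)) ^ 2 * a x) / (h n) ^ 2) atTop
        (𝓝 ((∫ s, (deriv f s) ^ 2 * a s) * (∫ s, s * deriv K s) ^ 2))) := by
  obtain ⟨B, hB⟩ := hfbdd
  obtain ⟨M, hM⟩ := hfd2bdd
  obtain ⟨-, -, -, -, hK12, -, hxK, -⟩ := hA1
  have hf1 : Differentiable ℝ f := hfd1
  have hKm : Measurable (deriv K) := measurable_deriv K
  have hKint : Integrable (deriv K) := by
    refine hK12.mono' hKm.aestronglyMeasurable (Eventually.of_forall fun z => ?_)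
    exact le_add_of_nonneg_right (abs_nonneg _)
  have hfm : Measurable f := hf1.continuous.measurable
  have hfabs : ∀ x, |f x| ≤ B := fun x => by rw [abs_of_pos (hfpos x)]; exact hB x
  have hgint : Integrable (fun z => |deriv K z| * B) := hKint.abs.mul_const B
  have hbound : ∀ n x z, |deriv K z * f (x - h n * z)| ≤ |deriv K z| * B := fun n x z => by
    rw [abs_mul]
    exact mul_le_mul_of_nonneg_left (hfabs _) (abs_nonneg _)
  constructor
  · intro _
    have key := tendsto_integral_sq_integral_mul
      (F := fun n x z => deriv K z * f (x - h n * z)) (F' := fun x z => deriv K z * f x)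
      (fun n => by unfold Function.uncurry; fun_prop) hgint hbound
      (fun x z => by
        refine Tendsto.const_mul _ ((hf1.continuous.tendsto x).comp ?_)
        simpa using (hh0.mul_const z).const_sub x)
      haint
    convert key using 2
    rw [← integral_mul_const]
    refine integral_congr_ae (Eventually.of_forall fun x => ?_)
    simp only [integral_mul_const]
    ring
  · intro hzero
    have hC := abs_deriv_le_of_bounded (fun x => (hfpos x).le) hB hf1 hfd2 hM
    have hlip : ∀ x y, |f y - f x| ≤ (B + M) * |y - x| := fun x y =>
      Convex.norm_image_sub_le_of_norm_deriv_le (fun w _ => hf1 w) (fun w _ => hC w) convex_univ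
        (Set.mem_univ x) (Set.mem_univ y)
    have key := tendsto_integral_sq_integral_mul
      (F := fun n x z => deriv K z * ((f (x - h n * z) - f x) / h n))
      (F' := fun x z => deriv K z * (-z * deriv f x))
      (fun n => by unfold Function.uncurry; fun_prop) (hxK.mul_const (B + M))
      (fun n x z => by
        have hquot : |(f (x - h n * z) - f x) / h n| ≤ (B + M) * |z| := by
          rw [abs_div, abs_of_pos (hhpos n), div_le_iff₀ (hhpos n)]
          refine (hlip x (x - h n * z)).trans_eq ?_
          rw [sub_sub_cancel_left, abs_neg, abs_mul, abs_of_pos (hhpos n)]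
          ring
        calc _ = |deriv K z| * |(f (x - h n * z) - f x) / h n| := abs_mul _ _
          _ ≤ |deriv K z| * ((B + M) * |z|) := by gcongr
          _ = |z * deriv K z| * (B + M) := by rw [abs_mul]; ring)
      (fun x z =>
        (tendsto_slope_sub_mul (hf1 x) (fun n => (hhpos n).ne') hh0 z).const_mul _)
      haint
    convert key using 2 with n
    · rw [← integral_div]
      refine integral_congr_ae (Eventually.of_forall fun x => ?_)
      have hKf : Integrable (fun z => deriv K z * f (x - h n * z)) :=
        hgint.mono' (by fun_prop) (Eventually.of_forall fun z => hbound n x z)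
      have hinner : ∫ z, deriv K z * ((f (x - h n * z) - f x) / h n)
          = (∫ z, deriv K z * f (x - h n * z)) / h n := by
        simp only [← mul_div_assoc, mul_sub]
        rw [integral_div, integral_sub hKf (hKint.mul_const _), integral_mul_const, hzero,
          zero_mul, sub_zero]
      simp only [hinner]
      ring
    · rw [← integral_mul_const]
      congr 1
      funext x
      have hinner : ∫ z, deriv K z * (-z * deriv f x)
          = -deriv f x * ∫ z, z * deriv K z := by
        rw [← integral_const_mul]
        refine integral_congr_ae (Eventually.of_forall fun z => ?_)
        ring
      simp only [hinner]
      ring
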